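/- Let f : X → Y be a perfect surjection of countable functional weight between paracompact Hausdorff spaces such that Y is a C-space. Then the set of all maps g ∈ C(X, I^∞) such that f × g : X → Y × I^∞ is an embedding is dense and G_δ in C(X, I^∞) equipped with the source limitation topology. -/

import Mathlib

open Set Topology

noncomputable section

/-- The `k`-dimensional cube `I^k`, viewed inside Euclidean space with the Euclidean metric. -/
def cube (k : ℕ) : Set (EuclideanSpace ℝ (Fin k)) := {x | ∀ i, x i ∈ Set.Icc (0:ℝ) 1}

/-- The Hilbert cube `I^∞`, embedded in `ℓ²` as a closed convex subset; its metric `d_∞` is the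
one induced by the `ℓ²` norm. -/
def HilbertCube : Set (lp (fun _ : ℕ => ℝ) 2) :=
  {x | ∀ i : ℕ, (x : ℕ → ℝ) i ∈ Set.Icc (0:ℝ) (1 / 2 ^ i)}

/-- Covering dimension of a topological space is at most `n` (as an integer, so that `n ≤ -1`
means the space is empty): every finite open cover admits an open shrinking of order `≤ n + 1`. -/
def CovDimLE (X : Type*) [TopologicalSpace X] (n : ℤ) : Prop :=
  ∀ (ι : Type) (U : ι → Set X), Finite ι → (∀ i, IsOpen (U i)) → (⋃ i, U i) = Set.univ →
    ∃ V : ι → Set X, (∀ i, IsOpen (V i)) ∧ (∀ i, V i ⊆ U i) ∧ (⋃ i, V i) = Set.univ ∧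
      ∀ x : X, (({i | x ∈ V i}).ncard : ℤ) ≤ n + 1

/-- A perfect map: continuous, closed, with compact fibers. -/
def IsPerfectMap {X Y : Type*} [TopologicalSpace X] [TopologicalSpace Y] (f : X → Y) : Prop :=
  Continuous f ∧ IsClosedMap f ∧ ∀ y : Y, IsCompact (f ⁻¹' {y})

/-- `f` has countable (functional) weight: there is a continuous `h : X → I^∞` such that the
diagonal product `f × h` embeds `X` into `Y × I^∞`. -/
def HasCountableFunctionalWeight {X Y : Type*} [TopologicalSpace X] [TopologicalSpace Y]
    (f : X → Y) : Prop :=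
  ∃ h : C(X, ↥HilbertCube), IsEmbedding (fun x => (f x, h x) : X → Y × ↥HilbertCube)

/-- `h` restricted to `A` is an `ω`-map: every point of `A` has a neighborhood `V` of its image
whose preimage within `A` is contained in some member of `ω`. -/
def IsOmegaMapOn {X Z : Type*} [TopologicalSpace X] [TopologicalSpace Z]
    (ω : Set (Set X)) (h : X → Z) (A : Set X) : Prop :=
  ∀ x ∈ A, ∃ V ∈ nhds (h x), ∃ W ∈ ω, A ∩ h ⁻¹' V ⊆ W

/-- A set `U ⊆ C(X, M)` is open in the source limitation (fine) topology: every `g ∈ U` admits a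
continuous `α : X → (0, ∞)` with `B̄(g, α) ⊆ U`. -/
def SLOpen {X M : Type*} [TopologicalSpace X] [PseudoMetricSpace M] (U : Set C(X, M)) : Prop :=
  ∀ g ∈ U, ∃ α : C(X, ℝ), (∀ x, 0 < α x) ∧
    {h : C(X, M) | ∀ x, dist (g x) (h x) ≤ α x} ⊆ U

/-- A set `D ⊆ C(X, M)` is dense in the source limitation topology. -/
def SLDense {X M : Type*} [TopologicalSpace X] [PseudoMetricSpace M] (D : Set C(X, M)) : Prop :=
  ∀ U : Set C(X, M), SLOpen U → U.Nonempty → (U ∩ D).Nonempty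

/-- A set `D ⊆ C(X, M)` is a `G_δ`-set in the source limitation topology. -/
def SLGdelta {X M : Type*} [TopologicalSpace X] [PseudoMetricSpace M] (D : Set C(X, M)) : Prop :=
  ∃ F : ℕ → Set C(X, M), (∀ i, SLOpen (F i)) ∧ D = ⋂ i, F i

/-- `Y` is a `C`-space: for every sequence `ω` of open covers there are pairwise disjoint open
families `γ i`, with `γ i` refining `ω i`, whose union covers `Y`. -/
def IsCSpace (Y : Type*) [TopologicalSpace Y] : Prop :=
  ∀ ω : ℕ → Set (Set Y), (∀ i, ∀ U ∈ ω i, IsOpen U) → (∀ i, ⋃₀ ω i = Set.univ) →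
    ∃ γ : ℕ → Set (Set Y),
      (∀ i, ∀ U ∈ γ i, IsOpen U) ∧
      (∀ i, (γ i).Pairwise Disjoint) ∧
      (∀ i, ∀ U ∈ γ i, ∃ W ∈ ω i, U ⊆ W) ∧
      ⋃₀ (⋃ i, γ i) = Set.univ

/-- A closed set `F` in a metric space `M` is a `Z_m`-set: the maps `I^m → M` avoiding `F` are
dense in the space of maps `I^m → M` with the uniform convergence (sup-metric) topology. -/
def IsZSet {M : Type*} [PseudoMetricSpace M] (m : ℕ) (F : Set M) : Prop :=
  IsClosed F ∧ Dense {u : BoundedContinuousFunction ↥(cube m) M | ∀ z, u z ∉ F}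

/-- A `σZ_m`-set: a countable union of closed `Z_m`-sets. -/
def IsSigmaZSet {M : Type*} [PseudoMetricSpace M] (m : ℕ) (S : Set M) : Prop :=
  ∃ F : ℕ → Set M, (∀ i, IsZSet m (F i)) ∧ S = ⋃ i, F i

/-- A `k`-plane in `ℝ^p`: the set where `p - k` fixed coordinates take fixed real values. -/
def IsPlane (p k : ℕ) (P : Set (EuclideanSpace ℝ (Fin p))) : Prop :=
  ∃ (s : Finset (Fin p)) (r : Fin p → ℝ), s.card = p - k ∧
    P = {x | ∀ i ∈ s, x i = r i}

/-- A rational `k`-plane in `ℝ^p`: the fixed coordinate values are rational. -/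
def IsRatPlane (p k : ℕ) (P : Set (EuclideanSpace ℝ (Fin p))) : Prop :=
  ∃ (s : Finset (Fin p)) (r : Fin p → ℚ), s.card = p - k ∧
    P = {x | ∀ i ∈ s, x i = (r i : ℝ)}

/-- Condition (R): `dim (g(f⁻¹(y)) ∩ Π) ≤ k - n - 1` for every `y ∈ Y` and every rational
`k`-plane `Π` in `ℝ^{2n+1+m}` with `0 ≤ k ≤ 2n`. -/
def ConditionR {X Y : Type*} [TopologicalSpace X] [TopologicalSpace Y]
    (f : X → Y) (n m : ℕ) (g : X → ↥(cube (2*n+1+m))) : Prop :=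
  ∀ y : Y, ∀ k : ℕ, k ≤ 2*n → ∀ P : Set (EuclideanSpace ℝ (Fin (2*n+1+m))),
    IsRatPlane (2*n+1+m) k P →
    CovDimLE ↥(((fun x => ((g x : EuclideanSpace ℝ (Fin (2*n+1+m))))) '' (f ⁻¹' {y})) ∩ P)
      ((k : ℤ) - n - 1)

/-- The restriction `f|B` is σ-perfect with countable weight: `B = ⋃ᵢ Bᵢ` with `Bᵢ ⊆ X` closed,
`f(Bᵢ) ⊆ Y` closed, and each `f|Bᵢ : Bᵢ → f(Bᵢ)` a perfect map of countable weight. -/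
def SigmaPerfectCW {X Y : Type*} [TopologicalSpace X] [TopologicalSpace Y]
    (f : X → Y) (B : Set X) : Prop :=
  ∃ Bi : ℕ → Set X, B = ⋃ i, Bi i ∧ ∀ i : ℕ,
    IsClosed (Bi i) ∧ IsClosed (f '' Bi i) ∧
    IsPerfectMap ((Set.mapsTo_image f (Bi i)).restrict f (Bi i) (f '' Bi i)) ∧
    HasCountableFunctionalWeight ((Set.mapsTo_image f (Bi i)).restrict f (Bi i) (f '' Bi i))

theorem hc_dist_sq (a b : lp (fun _ : ℕ => ℝ) 2) :
    dist a b ^ 2 = ∑' k, (a k - b k) ^ 2 := by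
  have h := lp.norm_rpow_eq_tsum (p := 2) (by norm_num) (a - b)
  rw [dist_eq_norm]
  simpa using h

theorem hc_summable (a b : lp (fun _ : ℕ => ℝ) 2) : Summable fun k => (a k - b k) ^ 2 := by
  have h := (lp.memℓp (a - b)).summable (by norm_num)
  simpa using h

theorem hc_pow (k : ℕ) : ((1:ℝ) / 2 ^ k) ^ 2 ≤ (1 / 2) ^ k := by
  have h1 : (1:ℝ) / 2 ^ k = (1/2) ^ k := by rw [div_pow, one_pow]
  rw [h1, sq]
  have h2 : ((1:ℝ)/2)^k ≤ 1 := pow_le_one₀ (by norm_num) (by norm_num)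
  have h3 : (0:ℝ) ≤ (1/2)^k := by positivity
  nlinarith

theorem hc_build {X : Type*} [TopologicalSpace X] (G : ℕ → X → ℝ) (hc : ∀ k, Continuous (G k))
    (hb : ∀ k x, G k x ∈ Set.Icc (0:ℝ) (1 / 2 ^ k)) :
    ∃ g : C(X, ↥HilbertCube), ∀ k x, (g x : lp (fun _ : ℕ => ℝ) 2) k = G k x := by
  have hs : Summable fun k : ℕ => ((1:ℝ)/2) ^ k := summable_geometric_two
  have hm : ∀ x, Memℓp (fun k => G k x) 2 := by
    intro x
    apply memℓp_gen
    refine Summable.of_nonneg_of_le (fun k => by positivity) (fun k => ?_) hs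
    have := hb k x
    have h2 : |G k x| ≤ 1 / 2 ^ k := by rw [abs_of_nonneg this.1]; exact this.2
    have h3 : |G k x| ^ 2 ≤ (1 / 2 ^ k) ^ 2 := by gcongr
    simpa using h3.trans (hc_pow k)
  let g : X → ↥HilbertCube := fun x => ⟨⟨fun k => G k x, hm x⟩, fun k => hb k x⟩
  have hg : ∀ k x, (g x : lp (fun _ : ℕ => ℝ) 2) k = G k x := fun k x => rfl
  refine ⟨⟨g, ?_⟩, hg⟩
  rw [continuous_iff_continuousAt]
  intro x0
  have hcont : Continuous fun x => ∑' k, (G k x - G k x0) ^ 2 := by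
    refine continuous_tsum (u := fun k => (1/2:ℝ)^k) (fun k => ?_) hs (fun k x => ?_)
    · have := hc k
      fun_prop
    · rw [Real.norm_eq_abs, abs_of_nonneg (sq_nonneg _)]
      refine le_trans ?_ (hc_pow k)
      rw [sq_le_sq, abs_of_nonneg (show (0:ℝ) ≤ 1 / 2 ^ k by positivity), abs_le]
      have h1 := hb k x
      have h2 := hb k x0
      constructor <;> linarith [h1.1, h1.2, h2.1, h2.2]
  have hd : ∀ x, dist (g x) (g x0) = Real.sqrt (∑' k, (G k x - G k x0) ^ 2) := by
    intro x
    rw [eq_comm, Real.sqrt_eq_iff_mul_self_eq (tsum_nonneg fun k => sq_nonneg _) dist_nonneg,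
      ← sq, Subtype.dist_eq, hc_dist_sq]
  rw [ContinuousAt, tendsto_iff_dist_tendsto_zero]
  simp only [hd]
  have := (Real.continuous_sqrt.comp hcont).tendsto x0
  simpa [Function.comp_def] using this

theorem emb_iff {X Y : Type*} [TopologicalSpace X] [TopologicalSpace Y]
    [T2Space Y] (f : X → Y) (hp : IsProperMap f) (g : C(X, ↥HilbertCube)) :
    IsEmbedding (fun x => (f x, g x) : X → Y × ↥HilbertCube) ↔
      ∀ x x', f x = f x' → g x = g x' → x = x' := by
  constructor
  · intro h x x' h1 h2
    exact h.injective (Prod.ext h1 h2)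
  · intro h
    have hcont : Continuous (fun x => (f x, g x) : X → Y × ↥HilbertCube) :=
      hp.continuous.prodMk g.continuous
    have : IsProperMap (fun x => (f x, g x) : X → Y × ↥HilbertCube) :=
      isProperMap_of_comp_of_t2 hcont continuous_fst hp
    exact (IsClosedEmbedding.of_continuous_injective_isClosedMap hcont
      (fun x x' e => h x x' (congrArg Prod.fst e) (congrArg Prod.snd e))
      this.isClosedMap).isEmbedding

theorem exists_close {X Y : Type*} [TopologicalSpace X] 
    (f : X → Y) (h : C(X, ↥HilbertCube)) (hh : ∀ x x', f x = f x' → h x = h x' → x = x')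
    (g0 : C(X, ↥HilbertCube)) (α : C(X, ℝ)) (hα : ∀ x, 0 < α x) :
    ∃ g : C(X, ↥HilbertCube), (∀ x, dist (g0 x) (g x) ≤ α x) ∧
      ∀ x x', f x = f x' → g x = g x' → x = x' := by
  have hcoord : ∀ (u : C(X, ↥HilbertCube)) (k : ℕ),
      Continuous fun x => (u x : lp (fun _ : ℕ => ℝ) 2) k := by
    intro u k
    have h1 : Continuous fun x => (u x : lp (fun _ : ℕ => ℝ) 2) :=
      continuous_subtype_val.comp u.continuous
    rw [continuous_iff_continuousAt]
    intro x0
    rw [ContinuousAt, tendsto_iff_dist_tendsto_zero]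
    have h2 := tendsto_iff_dist_tendsto_zero.1 (h1.tendsto x0)
    refine squeeze_zero (fun _ => dist_nonneg) (fun x => ?_) h2
    rw [dist_eq_norm, dist_eq_norm]
    exact lp.norm_apply_le_norm (by norm_num) ((u x : lp (fun _ : ℕ => ℝ) 2) - (u x0 : lp (fun _ : ℕ => ℝ) 2)) k
  let lam : ℕ → X → ℝ := fun k x => max 0 (min 1 ((k:ℝ) - 2 / α x ^ 2))
  have hlc : ∀ k, Continuous (lam k) := by
    intro k
    have : Continuous fun x => 2 / α x ^ 2 :=
      continuous_const.div (α.continuous.pow 2) (fun x => pow_ne_zero _ (hα x).ne')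
    exact continuous_const.max (continuous_const.min (continuous_const.sub this))
  have hl0 : ∀ k x, 0 ≤ lam k x := fun k x => le_max_left _ _
  have hl1 : ∀ k x, lam k x ≤ 1 := fun k x => max_le zero_le_one (min_le_left _ _)
  let G : ℕ → X → ℝ := fun k x =>
    (1 - lam k x) * (g0 x : lp (fun _ : ℕ => ℝ) 2) k +
      lam k x * ((1 / 2 ^ k) * (h x : lp (fun _ : ℕ => ℝ) 2) (Nat.unpair k).1)
  have hh1 : ∀ k x, (1 / 2 ^ k) * (h x : lp (fun _ : ℕ => ℝ) 2) (Nat.unpair k).1 ∈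
      Set.Icc (0:ℝ) (1 / 2 ^ k) := by
    intro k x
    have h1 := (h x).2 (Nat.unpair k).1
    have h2 : (1:ℝ) / 2 ^ (Nat.unpair k).1 ≤ 1 := by
      rw [div_le_one (by positivity)]; exact one_le_pow₀ (by norm_num)
    have h3 : (0:ℝ) < 1 / 2 ^ k := by positivity
    constructor
    · exact mul_nonneg h3.le h1.1
    · exact mul_le_of_le_one_right h3.le (h1.2.trans h2)
  obtain ⟨g, hg⟩ := hc_build G
    (fun k => ((continuous_const.sub (hlc k)).mul (hcoord g0 k)).add
      ((hlc k).mul (continuous_const.mul (hcoord h _))))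
    (fun k x => by
      have h1 := (g0 x).2 k
      exact (convex_Icc (0:ℝ) (1 / 2 ^ k)) h1 (hh1 k x) (sub_nonneg.2 (hl1 k x)) (hl0 k x)
        (by ring))
  refine ⟨g, fun x => ?_, fun x x' hf hgx => hh x x' hf ?_⟩
  · refine le_of_sq_le_sq ?_ (hα x).le
    rw [Subtype.dist_eq, hc_dist_sq]
    have hs : HasSum (fun k : ℕ => α x ^ 2 / 2 * (1/2:ℝ)^k) (α x ^ 2 / 2 * 2) :=
      hasSum_geometric_two.mul_left _
    have hle := (hc_summable (g0 x) (g x)).tsum_le_tsum (fun k => ?_) hs.summable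
    · rw [hs.tsum_eq] at hle
      linarith
    · rw [hg]
      have e : (g0 x : lp (fun _ : ℕ => ℝ) 2) k - G k x = lam k x *
        ((g0 x : lp (fun _ : ℕ => ℝ) 2) k -
          (1 / 2 ^ k) * (h x : lp (fun _ : ℕ => ℝ) 2) (Nat.unpair k).1) := by
        simp only [G]; ring
      rw [e, mul_pow]
      have hα2 : 0 < α x ^ 2 := pow_pos (hα x) 2
      by_cases hk : (k:ℝ) ≤ 2 / α x ^ 2
      · have : lam k x = 0 := max_eq_left ((min_le_right _ _).trans (by linarith))
        rw [this]
        have : 0 ≤ α x ^ 2 / 2 * (1/2:ℝ)^k := by positivity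
        simpa using this
      · push Not at hk
        have h1 := (g0 x).2 k
        have h2 := hh1 k x
        set A := (g0 x : lp (fun _ : ℕ => ℝ) 2) k
        set B := (1 / 2 ^ k) * (h x : lp (fun _ : ℕ => ℝ) 2) (Nat.unpair k).1
        have h3 : (A - B) ^ 2 ≤ (1 / 2 ^ k) ^ 2 := by
          rw [sq_le_sq, abs_of_nonneg (show (0:ℝ) ≤ 1 / 2 ^ k by positivity), abs_le]
          constructor <;> linarith [h1.1, h1.2, h2.1, h2.2]
        have h4 : lam k x ^ 2 ≤ 1 := pow_le_one₀ (hl0 k x) (hl1 k x)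
        have h5 : ((1:ℝ) / 2 ^ k) = (1/2) ^ k := by rw [div_pow, one_pow]
        have hkpos : (0:ℝ) < k := lt_trans (by positivity) hk
        have h6 : (1:ℝ) / 2 ^ k ≤ α x ^ 2 / 2 := by
          have h7 : (k:ℝ) < 2 ^ k := by exact_mod_cast Nat.lt_two_pow_self
          have h8 : 2 / α x ^ 2 < 2 ^ k := hk.trans h7
          rw [div_lt_iff₀ hα2] at h8
          rw [div_le_iff₀ (by positivity)]
          linarith
        calc lam k x ^ 2 * (A - B) ^ 2 ≤ 1 * (1 / 2 ^ k) ^ 2 :=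
              mul_le_mul h4 h3 (sq_nonneg _) zero_le_one
          _ = (1 / 2 ^ k) * (1/2) ^ k := by rw [one_mul, sq, ← h5]
          _ ≤ _ := by gcongr
  · apply Subtype.ext
    apply Subtype.ext
    funext j
    obtain ⟨N, hN⟩ := exists_nat_ge (max (2 / α x ^ 2 + 1) (2 / α x' ^ 2 + 1))
    set k := Nat.pair j N with hk
    have hkN : (N:ℝ) ≤ k := by exact_mod_cast Nat.right_le_pair j N
    have hu : (Nat.unpair k).1 = j := by simp [hk]
    have hx : ∀ z, 2 / α z ^ 2 + 1 ≤ N → (g z : lp (fun _ : ℕ => ℝ) 2) k =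
        1 / 2 ^ k * (h z : lp (fun _ : ℕ => ℝ) 2) j := by
      intro z hz
      have : lam k z = 1 := by
        have : min 1 ((k:ℝ) - 2 / α z ^ 2) = 1 := min_eq_left (by linarith)
        simp [lam, this]
      rw [hg]
      simp only [G, this, hu]
      ring
    have e1 := hx x ((le_max_left _ _).trans hN)
    have e2 := hx x' ((le_max_right _ _).trans hN)
    rw [hgx, e2] at e1
    have h3 : (1:ℝ) / 2 ^ k ≠ 0 := by positivity
    exact (mul_left_cancel₀ h3 e1).symm

theorem sep_open {X Y : Type*} [TopologicalSpace X] [TopologicalSpace Y]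
    [T2Space Y] [ParacompactSpace Y]
    (f : X → Y) (hp : IsProperMap f) (h : C(X, ↥HilbertCube)) (δ : ℝ) :
    SLOpen {g : C(X, ↥HilbertCube) |
      ∀ x x', f x = f x' → δ ≤ dist (h x) (h x') → g x ≠ g x'} := by
  intro g hg
  have hpp : IsProperMap (Prod.map f f) := hp.prodMap hp
  have hdh : Continuous fun p : X × X => dist (h p.1) (h p.2) := by fun_prop
  have hdg : Continuous fun p : X × X => dist (g p.1) (g p.2) := by fun_prop
  obtain ⟨β, hβ⟩ := exists_continuous_forall_mem_convex_of_local_const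
    (t := fun y : Y => {c : ℝ | 0 < c ∧ ∀ x x', f x = y → f x' = y → δ ≤ dist (h x) (h x') →
      2 * c < dist (g x) (g x')})
    (fun y => by
      apply Set.OrdConnected.convex
      constructor
      rintro a ⟨ha, -⟩ b ⟨-, hb⟩ c ⟨hac, hcb⟩
      exact ⟨ha.trans_le hac, fun x x' h1 h2 h3 => by linarith [hb x x' h1 h2 h3]⟩)
    (fun y => by
      have hK : IsCompact ((Prod.map f f) ⁻¹' {(y, y)} ∩
          {p : X × X | δ ≤ dist (h p.1) (h p.2)}) :=
        (hpp.isCompact_preimage isCompact_singleton).inter_right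
          (isClosed_le continuous_const hdh)
      obtain ⟨c, hc, hcK⟩ : ∃ c > 0, ∀ x x', f x = y → f x' = y → δ ≤ dist (h x) (h x') →
          2 * c < dist (g x) (g x') := by
        rcases Set.eq_empty_or_nonempty ((Prod.map f f) ⁻¹' {(y, y)} ∩
          {p : X × X | δ ≤ dist (h p.1) (h p.2)}) with he | hne
        · refine ⟨1, one_pos, fun x x' h1 h2 h3 => ?_⟩
          have : (x, x') ∈ (∅ : Set (X × X)) := by
            rw [← he]
            exact ⟨by simp [h1, h2], h3⟩
          exact this.elim
        · obtain ⟨p, hpK, hmin⟩ := hK.exists_isMinOn hne hdg.continuousOn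
          have hp1 : f p.1 = y ∧ f p.2 = y := by simpa [Prod.ext_iff] using hpK.1
          have hpos : 0 < dist (g p.1) (g p.2) :=
            dist_pos.2 (hg p.1 p.2 (hp1.1.trans hp1.2.symm) hpK.2)
          refine ⟨dist (g p.1) (g p.2) / 3, by positivity, fun x x' h1 h2 h3 => ?_⟩
          have : dist (g p.1) (g p.2) ≤ dist (g x) (g x') :=
            isMinOn_iff.1 hmin (x, x') ⟨by simp [h1, h2], h3⟩
          linarith
      have hB : IsClosed ({p : X × X | δ ≤ dist (h p.1) (h p.2)} ∩
          {p : X × X | dist (g p.1) (g p.2) ≤ 2 * c}) :=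
        (isClosed_le continuous_const hdh).inter (isClosed_le hdg continuous_const)
      have hC := (hpp.isClosedMap _ hB).preimage
        (show Continuous fun y : Y => (y, y) by fun_prop)
      refine ⟨c, ?_⟩
      have hn := hC.isOpen_compl.mem_nhds (x := y) (by
        rintro ⟨⟨x, x'⟩, ⟨h1, h2⟩, h3⟩
        have h4 : f x = y ∧ f x' = y := by simpa [Prod.ext_iff] using h3
        exact absurd (hcK x x' h4.1 h4.2 h1) (not_lt.2 h2))
      filter_upwards [hn] with y' hy'
      refine ⟨hc, fun x x' h1 h2 h3 => ?_⟩
      by_contra hlt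
      exact hy' ⟨(x, x'), ⟨h3, not_lt.1 hlt⟩, by simp [h1, h2]⟩)
  refine ⟨β.comp ⟨f, hp.continuous⟩, fun x => (hβ _).1, fun g' hg' x x' hf hd he => ?_⟩
  have h1 := (hβ (f x)).2 x x' rfl hf.symm hd
  have h2 : dist (g x) (g' x) ≤ β (f x) := hg' x
  have h3 : dist (g x') (g' x') ≤ β (f x) := by rw [hf]; exact hg' x'
  rw [← he, dist_comm] at h3
  linarith [dist_triangle (g x) (g' x) (g x')]

/-- Theorem 1.1(ii). Let `f : X → Y` be a perfect surjection of countable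
functional weight between paracompact Hausdorff spaces with `Y` a `C`-space. Then the set of all
`g ∈ C(X, I^∞)` for which `f × g` is an embedding into `Y × I^∞` is dense and `G_δ` in
`C(X, I^∞)` with the source limitation topology. -/
theorem stmt1 {X Y : Type*} [TopologicalSpace X] [TopologicalSpace Y]
    [T2Space X] [T2Space Y] [ParacompactSpace X] [ParacompactSpace Y]
    (f : X → Y) (hperf : IsPerfectMap f) (hsurj : Function.Surjective f)
    (hw : HasCountableFunctionalWeight f) (hC : IsCSpace Y) :
    SLDense {g : C(X, ↥HilbertCube) |
        IsEmbedding (fun x => (f x, g x) : X → Y × ↥HilbertCube)} ∧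
    SLGdelta {g : C(X, ↥HilbertCube) |
        IsEmbedding (fun x => (f x, g x) : X → Y × ↥HilbertCube)} := by
  have hp : IsProperMap f := isProperMap_iff_isClosedMap_and_compact_fibers.2
    ⟨hperf.1, hperf.2.1, hperf.2.2⟩
  obtain ⟨h, hh⟩ := hw
  rw [emb_iff f hp] at hh
  simp only [emb_iff f hp]
  constructor
  · rintro U hU ⟨g0, hg0⟩
    obtain ⟨α, hα, hsub⟩ := hU g0 hg0
    obtain ⟨g, hg, hinj⟩ := exists_close f h hh g0 α hα
    exact ⟨g, hsub hg, hinj⟩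
  · refine ⟨fun n => {g : C(X, ↥HilbertCube) |
      ∀ x x', f x = f x' → 1 / ((n:ℝ) + 1) ≤ dist (h x) (h x') → g x ≠ g x'},
      fun n => sep_open f hp h _, ?_⟩
    ext g
    simp only [Set.mem_ofPred_eq, Set.mem_iInter]
    constructor
    · intro hg n x x' hf hd he
      have := hg x x' hf he
      subst this
      rw [dist_self] at hd
      have : 0 < 1 / ((n:ℝ) + 1) := by positivity
      linarith
    · intro hg x x' hf he
      refine hh x x' hf ?_
      by_contra hne
      obtain ⟨n, hn⟩ := exists_nat_one_div_lt (dist_pos.2 hne)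
      exact hg n x x' hf hn.le he
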